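/- Let X be a nonempty set, n ≥ 3, and let F : X^n → X be associative and quasitrivial on D^n_{n-1}. Then F is quasitrivial (on all of X^n) if and only if F has at most two neutral elements, i.e., |E_F| ≤ 2. -/

import Mathlib

variable {X : Type*}

/-- The result of substituting `F` applied to the `n` consecutive entries starting at
position `i` of the `(2n-1)`-tuple `x` (given as the first `2n-1` values of `x : ℕ → X`),
and then applying `F` to the resulting `n`-tuple. -/
def naryCompAt (n : ℕ) (F : (Fin n → X) → X) (x : ℕ → X) (i : ℕ) : X :=
  F fun j => if (j : ℕ) < i then x j
    else if (j : ℕ) = i then F (fun k => x (i + (k : ℕ)))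
    else x ((j : ℕ) + n - 1)

/-- `F` is an associative `n`-ary operation. -/
def NAryAssociative (n : ℕ) (F : (Fin n → X) → X) : Prop :=
  ∀ (x : ℕ → X) (i : ℕ), i + 1 ≤ n - 1 → naryCompAt n F x i = naryCompAt n F x (i + 1)

/-- `e` is a neutral element for the `n`-ary operation `F`: inserting the argument `a` at
any position `p`, with `e` at all the other positions, returns `a`. -/
def NAryNeutral (n : ℕ) (F : (Fin n → X) → X) (e : X) : Prop :=
  ∀ (a : X) (p : Fin n), F (Function.update (fun _ => e) p a) = a

/-- The set `E_F` of neutral elements for `F`. -/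
def naryNeutralSet (n : ℕ) (F : (Fin n → X) → X) : Set X :=
  {e | NAryNeutral n F e}

/-- `e` is a neutral element for the restriction of `F` to `S^n`. -/
def NAryNeutralOn (n : ℕ) (F : (Fin n → X) → X) (S : Set X) (e : X) : Prop :=
  e ∈ S ∧ ∀ a ∈ S, ∀ p : Fin n, F (Function.update (fun _ => e) p a) = a

/-- `iterOp G m x = G (x 0) (G (x 1) (⋯ (G (x (m-1)) (x m))⋯))`,
the `m`-fold iterate of the binary operation `G`, applied to `m+1` arguments. -/
def iterOp (G : X → X → X) : ℕ → (ℕ → X) → X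
  | 0, x => x 0
  | m + 1, x => G (x 0) (iterOp G m fun i => x (i + 1))

/-- The `n`-ary operation `F` is reducible to the binary operation `G`, i.e. `F` is the
`(n-1)`-fold iterate of `G`. -/
def NAryReducibleTo (n : ℕ) (F : (Fin n → X) → X) (G : X → X → X) : Prop :=
  ∀ x : ℕ → X, F (fun i : Fin n => x i) = iterOp G (n - 1) x

/-- `gPow G a m` is the `G`-product of `m + 1` copies of `a`. -/
def gPow (G : X → X → X) (a : X) : ℕ → X
  | 0 => a
  | m + 1 => G a (gPow G a m)

/-- `(Y, G)` is an Abelian group whose exponent divides `m` (for `m ≥ 1`): `G` maps `Y × Y`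
into `Y` and is commutative and associative on `Y`, and `Y` contains a neutral element `e`
for which every element of `Y` has an inverse and such that the `G`-product of `m` copies of
any element of `Y` equals `e`. -/
def IsAbelianGroupOfExpDvdOn (Y : Set X) (G : X → X → X) (m : ℕ) : Prop :=
  (∀ a ∈ Y, ∀ b ∈ Y, G a b ∈ Y) ∧
  (∀ a ∈ Y, ∀ b ∈ Y, G a b = G b a) ∧
  (∀ a ∈ Y, ∀ b ∈ Y, ∀ c ∈ Y, G (G a b) c = G a (G b c)) ∧
  ∃ e ∈ Y, (∀ a ∈ Y, G e a = a) ∧ (∀ a ∈ Y, ∃ b ∈ Y, G a b = e) ∧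
    (∀ a ∈ Y, gPow G a (m - 1) = e)

/-- The tuple `x` lies in `D^n_k`: at least `k` of its components are equal to each other. -/
def MemD (n k : ℕ) (x : Fin n → X) : Prop :=
  ∃ S : Finset (Fin n), k ≤ S.card ∧ ∀ i ∈ S, ∀ j ∈ S, x i = x j

/-- `F` is quasitrivial on `D^n_k`. -/
def NAryQuasitrivialOnD (n k : ℕ) (F : (Fin n → X) → X) : Prop :=
  ∀ x : Fin n → X, MemD n k x → F x ∈ Set.range x

/-- `F` is quasitrivial on `S^n_k`, the set of tuples taking at most `k` distinct values. -/
def NAryQuasitrivialOnS (n k : ℕ) (F : (Fin n → X) → X) : Prop :=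
  ∀ x : Fin n → X, (Set.range x).encard ≤ k → F x ∈ Set.range x

/-- `F` is quasitrivial. -/
def NAryQuasitrivial (n : ℕ) (F : (Fin n → X) → X) : Prop :=
  ∀ x : Fin n → X, F x ∈ Set.range x

section Envelope

/-- `F` applied to the first `n` entries of a list, padded with `d`. -/
def listApply (n : ℕ) (F : (Fin n → X) → X) (d : X) (l : List X) : X :=
  F fun i => l.getD i d

/-- Repeatedly replace the first `n` entries of a list by their `F`-value, and return the
remaining entry if exactly one is left in the end. -/
def listEval (n : ℕ) (F : (Fin n → X) → X) (d : X) (l : List X) : Option X :=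
  if 2 ≤ n ∧ n ≤ l.length then listEval n F d (listApply n F d (l.take n) :: l.drop n)
  else if l.length = 1 then l.head? else none
termination_by l.length
decreasing_by simp; omega

theorem listEval_append {n : ℕ} (hn : 2 ≤ n) (F : (Fin n → X) → X) (d : X) (u v : List X)
    (hu : u.length = n) :
    listEval n F d (u ++ v) = listEval n F d (listApply n F d u :: v) := by
  rw [listEval, if_pos ⟨hn, by simp [hu]⟩, List.take_left' hu, List.drop_left' hu]

theorem listEval_eq_none {n : ℕ} (F : (Fin n → X) → X) (d : X) (l : List X)
    (h : l.length < n) (h₁ : l.length ≠ 1) : listEval n F d l = none := by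
  rw [listEval, if_neg (by omega), if_neg h₁]

theorem listEval_singleton {n : ℕ} (hn : 2 ≤ n) (F : (Fin n → X) → X) (d x : X) :
    listEval n F d [x] = some x := by
  rw [listEval, if_neg (by simp; omega)]
  simp

theorem listApply_append_cons {n : ℕ} (F : (Fin n → X) → X) (d : X) (u w v : List X)
    (hw : w.length = n) (huv : u.length + v.length + 1 = n) :
    listApply n F d (u ++ listApply n F d w :: v) =
      naryCompAt n F (fun j => (u ++ w ++ v).getD j d) u.length := by
  unfold naryCompAt
  rw [listApply]
  congr 1
  funext j
  have hj := j.2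
  split_ifs with h₁ h₂
  · simp [List.getD, List.getElem?_append, h₁]
  · rw [h₂]
    simp only [List.getD, List.append_assoc, List.getElem?_append_right le_rfl, Nat.sub_self]
    simp only [List.getElem?_cons_zero, Option.getD_some, listApply]
    congr 1
    funext k
    have hk := k.2
    simp [List.getD, List.getElem?_append, hw]
  · simp only [List.getD, List.append_assoc]
    rw [List.getElem?_append_right (by omega), List.getElem?_append_right (by omega),
      List.getElem?_append_right (by omega), List.getElem?_cons, if_neg (by omega)]
    congr 2
    omega

theorem NAryAssociative.naryCompAt_eq {n : ℕ} {F : (Fin n → X) → X} (hF : NAryAssociative n F)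
    (x : ℕ → X) (i : ℕ) (hi : i ≤ n - 1) : naryCompAt n F x i = naryCompAt n F x 0 := by
  induction i with
  | zero => rfl
  | succ i ih => rw [← hF x i hi, ih (by omega)]

theorem NAryAssociative.listEval_append_append {n : ℕ} (hn : 2 ≤ n) {F : (Fin n → X) → X}
    (hF : NAryAssociative n F) (d : X) (u w v : List X) (hw : w.length = n) :
    listEval n F d (u ++ w ++ v) = listEval n F d (u ++ listApply n F d w :: v) := by
  induction h : u.length using Nat.strong_induction_on generalizing u with
  | _ k ih =>
  subst h
  by_cases hu : n ≤ u.length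
  · obtain ⟨a, b, rfl, ha⟩ : ∃ a b, u = a ++ b ∧ a.length = n :=
      ⟨u.take n, u.drop n, by simp, by simpa using hu⟩
    simp only [List.append_assoc]
    rw [listEval_append hn _ _ _ _ ha, listEval_append hn _ _ _ _ ha]
    simpa using ih (b.length + 1) (by simp; omega) (listApply n F d a :: b) (by simp)
  by_cases hu0 : u = []
  · subst hu0
    simpa using listEval_append hn F d w v hw
  have hu1 : 0 < u.length := List.length_pos_iff.2 hu0
  by_cases hlen : u.length + v.length + 1 < n
  · rw [listEval_eq_none F d (u ++ _ :: v) (by simp; omega) (by simp; omega),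
      ← List.take_append_drop n (u ++ w ++ v),
      listEval_append hn _ _ _ _ (by simp; omega), listEval_eq_none]
    all_goals simp; omega
  · obtain ⟨v₁, v₂, rfl, hv₁⟩ : ∃ a b, v = a ++ b ∧ u.length + a.length + 1 = n :=
      ⟨v.take (n - 1 - u.length), v.drop (n - 1 - u.length), by simp, by simp; omega⟩
    obtain ⟨c, e, hce, hc⟩ : ∃ c e, u ++ w ++ v₁ = c ++ e ∧ c.length = n :=
      ⟨(u ++ w ++ v₁).take n, (u ++ w ++ v₁).drop n, by simp, by simp; omega⟩
    have he : e.length + 1 = n := by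
      have := congrArg List.length hce
      simp at this
      omega
    rw [← List.append_assoc, hce, List.append_assoc, listEval_append hn _ _ _ _ hc,
      ← List.cons_append, listEval_append hn _ _ _ _ (by simp; omega),
      ← List.cons_append, ← List.append_assoc,
      listEval_append hn _ _ (u ++ _) _ (by simp; omega)]
    congr 2
    have h₁ := listApply_append_cons F d u w v₁ hw hv₁
    have h₂ := listApply_append_cons F d [] c e hc (by simpa using he)
    rw [hF.naryCompAt_eq _ _ (by omega), hce] at h₁
    rw [h₁]
    exact h₂

/-- The syntactic congruence of a function on a free monoid. -/
def syntacticCon {α β : Type*} (f : FreeMonoid α → β) : Con (FreeMonoid α) where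
  r u v := ∀ a b, f (a * u * b) = f (a * v * b)
  iseqv := ⟨fun _ _ _ => rfl, fun h a b => (h a b).symm, fun h h' a b => (h a b).trans (h' a b)⟩
  mul' {u v w z} h h' a b := by
    have h₁ := h a (w * b)
    have h₂ := h' (a * v) b
    simp only [mul_assoc] at h₁ h₂ ⊢
    rw [h₁, h₂]

/-- An associative `n`-ary operation is the restriction of an `n`-fold product in a monoid. -/
theorem NAryAssociative.exists_monoid.{u} {Y : Type u} [Nonempty Y] {n : ℕ} (hn : 2 ≤ n)
    {F : (Fin n → Y) → Y} (hF : NAryAssociative n F) :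
    ∃ (M : Type u) (_ : Monoid M) (ι : Y → M), Function.Injective ι ∧
      ∀ x, ι (F x) = (List.ofFn fun i => ι (x i)).prod := by
  obtain ⟨d⟩ := ‹Nonempty Y›
  let c := syntacticCon fun w : FreeMonoid Y => listEval n F d w.toList
  let ι : Y → c.Quotient := fun x => c.mk' (FreeMonoid.of x)
  have hι (l : List Y) : (l.map ι).prod = c.mk' (FreeMonoid.ofList l) := by
    induction l with
    | nil => simp
    | cons x l ih => rw [List.map_cons, List.prod_cons, ih, FreeMonoid.ofList_cons, map_mul]
  refine ⟨c.Quotient, inferInstance, ι, fun x y hxy => ?_, fun x => ?_⟩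
  · have h := (Con.eq c).1 hxy 1 1
    simpa [listEval_singleton hn] using h
  · have hx : (List.ofFn fun i => ι (x i)) = (List.ofFn x).map ι := by
      rw [List.map_ofFn]; rfl
    rw [hx, hι]
    refine (Con.eq c).2 fun a b => ?_
    have h := hF.listEval_append_append hn d a.toList (List.ofFn x) b.toList (by simp)
    have hFx : listApply n F d (List.ofFn x) = F x := by
      simp [listApply, List.getD]
    rw [hFx] at h
    simpa [FreeMonoid.toList_mul, FreeMonoid.toList_of] using h.symm

end Envelope

section Monoid

variable {M : Type*} [Monoid M] {m : ℕ} {S : Set M}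

/-- Every product of `m + 1` factors from `S` all of which, except possibly one, are equal,
is one of its factors. -/
def SandwichClosed (m : ℕ) (S : Set M) : Prop :=
  ∀ x ∈ S, ∀ y ∈ S, ∀ k l, k + l = m → x ^ k * y * x ^ l = x ∨ x ^ k * y * x ^ l = y

/-- The `m`-th power of `e ∈ S` acts as the identity on `S` from both sides. -/
def IsPowNeutral (m : ℕ) (S : Set M) (e : M) : Prop :=
  e ∈ S ∧ ∀ x ∈ S, e ^ m * x = x ∧ x * e ^ m = x

namespace SandwichClosed

theorem pow_succ_eq (H : SandwichClosed m S) {x : M} (hx : x ∈ S) : x ^ (m + 1) = x := by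
  have := H x hx x hx 0 m (by simp)
  simpa [pow_succ'] using this

theorem pow_mul_self (H : SandwichClosed m S) {x : M} (hx : x ∈ S) : x ^ m * x = x := by
  rw [← pow_succ, H.pow_succ_eq hx]

theorem mul_pow_self (H : SandwichClosed m S) {x : M} (hx : x ∈ S) : x * x ^ m = x := by
  rw [← pow_succ', H.pow_succ_eq hx]

theorem pow_mul_mul_pow_eq (H : SandwichClosed m S) {x y : M} (hx : x ∈ S) (hy : y ∈ S)
    (h₁ : x ^ m * y = y) (h₂ : y * x ^ m = y) {k l : ℕ} (hkl : k + l = m) :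
    x ^ k * y * x ^ l = y := by
  rcases H x hx y hy k l hkl with h | h
  · have hy' : y = x ^ l * (x ^ k * y * x ^ l) * x ^ k := by
      calc y = x ^ m * y * x ^ m := by rw [h₁, h₂]
        _ = x ^ (l + k) * y * x ^ (l + k) := by rw [add_comm, hkl]
        _ = _ := by simp only [pow_add, mul_assoc]
    rw [h, ← pow_succ, ← pow_add, show l + 1 + k = m + 1 by omega, H.pow_succ_eq hx] at hy'
    rw [h, hy']
  · exact h

theorem commute (H : SandwichClosed m S) (hm : 1 ≤ m) {x y : M} (hx : x ∈ S) (hy : y ∈ S)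
    (h₁ : x ^ m * y = y) (h₂ : y * x ^ m = y) : Commute x y := by
  have h := H.pow_mul_mul_pow_eq hx hy h₁ h₂ (k := 1) (l := m - 1) (by omega)
  calc x * y = x * (y * x ^ m) := by rw [h₂]
    _ = x ^ 1 * y * x ^ (m - 1) * x := by
        rw [mul_assoc _ _ x, ← pow_succ, Nat.sub_add_cancel hm, pow_one, mul_assoc]
    _ = y * x := by rw [h]

theorem pow_eq_pow (hm : 1 ≤ m) {x y : M} (h₁ : x ^ m * y = y) (h₂ : x * y ^ m = x) :
    x ^ m = y ^ m := by
  obtain ⟨k, rfl⟩ : ∃ k, m = k + 1 := ⟨m - 1, by omega⟩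
  calc x ^ (k + 1) = x ^ k * (x * y ^ (k + 1)) := by rw [h₂, pow_succ]
    _ = x ^ (k + 1) * y * y ^ k := by rw [pow_succ' y, pow_succ x]; simp only [mul_assoc]
    _ = y ^ (k + 1) := by rw [h₁, pow_succ']

theorem isPowNeutral_of_pow_eq (H : SandwichClosed m S) {x y : M} (hx : x ∈ S) (hy : y ∈ S)
    (hxy : x ≠ y) (h : x ^ m = y ^ m) : IsPowNeutral m S x := by
  refine ⟨hx, fun z hz => ⟨?_, ?_⟩⟩
  · have h₁ := H x hx z hz m 0 (by simp)
    have h₂ := H y hy z hz m 0 (by simp)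
    rw [← h] at h₂
    simp only [pow_zero, mul_one] at h₁ h₂
    grind
  · have h₁ := H x hx z hz 0 m (by simp)
    have h₂ := H y hy z hz 0 m (by simp)
    rw [← h] at h₂
    simp only [pow_zero, one_mul] at h₁ h₂
    grind

theorem mul_eq_or_isPowNeutral (H : SandwichClosed m S) (hm : 1 ≤ m) {x y : M}
    (hx : x ∈ S) (hy : y ∈ S) (hxy : x ≠ y) :
    x * y = x * x ∨ x * y = y * y ∨ IsPowNeutral m S x ∧ IsPowNeutral m S y := by
  have h₁ := H x hx y hy m 0 (by simp)
  have h₂ := H y hy x hx 0 m (by simp)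
  simp only [pow_zero, mul_one, one_mul] at h₁ h₂
  rcases h₁ with h₁ | h₁
  · left
    nth_rw 1 [← H.mul_pow_self hx]
    rw [mul_assoc, h₁]
  rcases h₂ with h₂ | h₂
  · right; left
    nth_rw 1 [← H.pow_mul_self hy]
    rw [← mul_assoc, h₂]
  have h := pow_eq_pow hm h₁ h₂
  exact .inr (.inr ⟨H.isPowNeutral_of_pow_eq hx hy hxy h,
    H.isPowNeutral_of_pow_eq hy hx hxy.symm h.symm⟩)

end SandwichClosed

namespace IsPowNeutral

theorem pow_eq (hm : 1 ≤ m) {e f : M} (he : IsPowNeutral m S e) (hf : IsPowNeutral m S f) :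
    e ^ m = f ^ m :=
  SandwichClosed.pow_eq_pow hm (he.2 f hf.1).1 (hf.2 e he.1).2

theorem commute (H : SandwichClosed m S) (hm : 1 ≤ m) {e x : M} (he : IsPowNeutral m S e)
    (hx : x ∈ S) : Commute e x :=
  H.commute hm he.1 hx (he.2 x hx).1 (he.2 x hx).2

theorem mul_left_cancel (hm : 1 ≤ m) {e x y : M} (he : IsPowNeutral m S e) (hx : x ∈ S)
    (hy : y ∈ S) (h : e * x = e * y) : x = y := by
  rw [← (he.2 x hx).1, ← (he.2 y hy).1, ← Nat.sub_add_cancel hm, pow_succ, mul_assoc, mul_assoc, h]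

theorem mul_eq_mul_self (H : SandwichClosed m S) (hm : 1 ≤ m) {e x : M}
    (he : IsPowNeutral m S e) (hx : x ∈ S) (hx' : ¬ IsPowNeutral m S x) :
    e * x = x * x := by
  have hne : e ≠ x := by rintro rfl; exact hx' he
  rcases H.mul_eq_or_isPowNeutral hm he.1 hx hne with h | h | h
  · exact absurd (he.mul_left_cancel hm hx he.1 h).symm hne
  · exact h
  · exact absurd h.2 hx'

/-- If `e ^ (m - 1) * f * g` is one of its factors, that factor can only be `e`, so that
`f * g = e * e`. -/
theorem mul_eq_sq (H : SandwichClosed m S) (hm : 2 ≤ m) {e f g : M}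
    (he : IsPowNeutral m S e) (hf : IsPowNeutral m S f) (hg : IsPowNeutral m S g)
    (hef : e ≠ f) (heg : e ≠ g) (h : e ^ (m - 1) * f * g ∈ ({e, f, g} : Set M)) :
    f * g = e * e := by
  have key : e * (e ^ (m - 1) * f * g) = f * g := by
    rw [← mul_assoc, ← mul_assoc, ← pow_succ', Nat.sub_add_cancel (by omega), (he.2 f hf.1).1]
  have comm := he.commute H (by omega) hf.1
  rcases h with h | h | h
  · rw [← key, h]
  · rw [h, comm.eq] at key
    exact absurd (hf.mul_left_cancel (by omega) he.1 hg.1 key) heg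
  · rw [h, (he.commute H (by omega) hg.1).eq, (hf.commute H (by omega) hg.1).eq] at key
    exact absurd (hg.mul_left_cancel (by omega) he.1 hf.1 key) hef

theorem pow_mul_sq (H : SandwichClosed m S) (hm : 1 ≤ m) {e f : M}
    (he : IsPowNeutral m S e) (hf : IsPowNeutral m S f) (h : e ^ (m - 1) * f * f ∈ S) :
    IsPowNeutral m S (e ^ (m - 1) * f * f) := by
  have comm := he.commute H hm hf.1
  have hpow : (e ^ (m - 1) * f * f) ^ m = (e ^ m) ^ (m + 1) := by
    rw [((comm.pow_left _).mul_left (Commute.refl f)).mul_pow, (comm.pow_left _).mul_pow,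
      ← hf.pow_eq hm he, ← pow_mul, mul_comm, pow_mul, hf.pow_eq hm he, ← pow_succ, ← pow_succ,
      Nat.sub_add_cancel hm]
  have left : ∀ x ∈ S, ∀ k, (e ^ m) ^ k * x = x := by
    intro x hx k
    induction k with
    | zero => simp
    | succ k ih => rw [pow_succ, mul_assoc, (he.2 x hx).1, ih]
  have right : ∀ x ∈ S, ∀ k, x * (e ^ m) ^ k = x := by
    intro x hx k
    induction k with
    | zero => simp
    | succ k ih => rw [pow_succ', ← mul_assoc, (he.2 x hx).2, ih]
  exact ⟨h, fun x hx => by rw [hpow]; exact ⟨left x hx _, right x hx _⟩⟩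

end IsPowNeutral

/-- If `S` has at most two pow-neutral elements and they have the same square, then a product of
elements of `S` is a power of one of its factors, or has the form `e ^ j * f` for two distinct
pow-neutral factors `e`, `f`. -/
theorem SandwichClosed.prod_eq (H : SandwichClosed m S) (hm : 1 ≤ m)
    (hsq : ∀ e f, IsPowNeutral m S e → IsPowNeutral m S f → f * f = e * e)
    (htwo : ∀ e f g, IsPowNeutral m S e → IsPowNeutral m S f → IsPowNeutral m S g →
      e = f ∨ e = g ∨ f = g)
    (j : ℕ) (l : List M) (hl : ∀ x ∈ l, x ∈ S) (hlen : l.length = j + 1) :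
    (∃ z ∈ l, l.prod = z ^ (j + 1)) ∨
      ∃ e ∈ l, ∃ f ∈ l, IsPowNeutral m S e ∧ IsPowNeutral m S f ∧ e ≠ f ∧ l.prod = e ^ j * f := by
  induction j generalizing l with
  | zero =>
    obtain ⟨x, rfl⟩ := List.length_eq_one_iff.1 hlen
    exact .inl ⟨x, by simp⟩
  | succ j ih =>
    obtain ⟨l, x, rfl⟩ : ∃ l' x, l = l' ++ [x] :=
      ⟨_, _, (List.dropLast_append_getLast (List.ne_nil_of_length_eq_add_one hlen)).symm⟩
    have hx : x ∈ S := hl x (by simp)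
    rcases ih l (fun y hy => hl y (by simp [hy])) (by simpa using hlen) with
      ⟨z, hz, h⟩ | ⟨e, hel, f, hfl, he, hf, hef, h⟩
    · have hprod : (l ++ [x]).prod = z ^ (j + 1) * x := by simp [h]
      have hzS : z ∈ S := hl z (by simp [hz])
      by_cases hzx : z = x
      · subst hzx
        exact .inl ⟨z, by simp, by rw [hprod, pow_succ _ (j + 1)]⟩
      rcases H.mul_eq_or_isPowNeutral hm hzS hx hzx with h' | h' | ⟨h₁, h₂⟩
      · refine .inl ⟨z, by simp [hz], ?_⟩
        rw [hprod, pow_succ, mul_assoc, h', ← mul_assoc, ← pow_succ, ← pow_succ]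
      · refine .inl ⟨x, by simp, ?_⟩
        have (k : ℕ) : z ^ k * x = x ^ (k + 1) := by
          induction k with
          | zero => simp
          | succ k ih => rw [pow_succ, mul_assoc, h', ← mul_assoc, ih, ← pow_succ]
        rw [hprod, this]
      · exact .inr ⟨z, by simp [hz], x, by simp, h₁, h₂, hzx, hprod⟩
    · have hprod : (l ++ [x]).prod = e ^ j * f * x := by simp [h]
      by_cases hxn : IsPowNeutral m S x
      · obtain rfl | rfl : e = x ∨ f = x := by have := htwo e f x he hf hxn; tauto
        · refine .inr ⟨e, by simp, f, by simp [hfl], he, hf, hef, ?_⟩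
          rw [hprod, mul_assoc, (hf.commute H hm hx).eq, ← mul_assoc, ← pow_succ]
        · refine .inl ⟨e, by simp [hel], ?_⟩
          rw [hprod, mul_assoc, hsq e f he hf, ← mul_assoc, ← pow_succ, ← pow_succ]
      · refine .inl ⟨x, by simp, ?_⟩
        have (k : ℕ) : e ^ k * x = x ^ (k + 1) := by
          induction k with
          | zero => simp
          | succ k ih =>
            rw [pow_succ, mul_assoc, he.mul_eq_mul_self H hm hx hxn, ← mul_assoc, ih, ← pow_succ]
        rw [hprod, mul_assoc, hf.mul_eq_mul_self H hm hx hxn, ← mul_assoc, this, ← pow_succ]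

end Monoid

section Embedding

variable {M : Type*} [Monoid M] {m : ℕ} {F : (Fin (m + 1) → X) → X} {ι : X → M}

theorem List.ofFn_update_const {α : Type*} {k l m : ℕ} (hkl : k + l = m) (e a : α)
    (p : Fin (m + 1)) (hp : (p : ℕ) = k) :
    List.ofFn (Function.update (fun _ => e) p a) =
      List.replicate k e ++ a :: List.replicate l e := by
  apply List.ext_getElem
  · simp; omega
  · intro i h₁ h₂
    rw [List.getElem_ofFn, Function.update_apply]
    simp only [Fin.ext_iff, hp, List.getElem_append, List.getElem_replicate,
      List.length_replicate, List.getElem_cons]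
    split_ifs <;> first | rfl | omega

theorem map_update_const (hι : ∀ x, ι (F x) = (List.ofFn fun i => ι (x i)).prod) {k l : ℕ}
    (hkl : k + l = m) (e a : X) (p : Fin (m + 1)) (hp : (p : ℕ) = k) :
    ι (F (Function.update (fun _ => e) p a)) = ι e ^ k * ι a * ι e ^ l := by
  have h : (fun i => ι (Function.update (fun _ => e) p a i)) =
      Function.update (fun _ => ι e) p (ι a) := by
    funext i
    exact Function.apply_update (fun _ => ι) _ p a i
  rw [hι, h, List.ofFn_update_const hkl _ _ _ hp]
  simp [mul_assoc]

theorem NAryQuasitrivialOnD.sandwichClosed (hQ : NAryQuasitrivialOnD (m + 1) m F)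
    (hι : ∀ x, ι (F x) = (List.ofFn fun i => ι (x i)).prod) :
    SandwichClosed m (Set.range ι) := by
  rintro _ ⟨e, rfl⟩ _ ⟨a, rfl⟩ k l hkl
  let p : Fin (m + 1) := ⟨k, by omega⟩
  obtain ⟨i, hi⟩ := hQ (Function.update (fun _ => e) p a) ⟨{p}ᶜ, by simp [Finset.card_compl],
    fun i hi j hj => by
      rw [Function.update_of_ne (by simpa using hi), Function.update_of_ne (by simpa using hj)]⟩
  rw [← map_update_const hι hkl e a p rfl, ← hi, Function.update_apply]
  split_ifs <;> simp

theorem naryNeutral_iff_isPowNeutral (hinj : Function.Injective ι)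
    (hι : ∀ x, ι (F x) = (List.ofFn fun i => ι (x i)).prod)
    (H : SandwichClosed m (Set.range ι)) (e : X) :
    NAryNeutral (m + 1) F e ↔ IsPowNeutral m (Set.range ι) (ι e) := by
  constructor
  · refine fun h => ⟨⟨e, rfl⟩, ?_⟩
    rintro _ ⟨x, rfl⟩
    have h₁ := map_update_const hι (k := m) (l := 0) (by omega) e x (Fin.last m) (by simp)
    have h₂ := map_update_const hι (k := 0) (l := m) (by omega) e x 0 (by simp)
    rw [h] at h₁ h₂
    simp only [pow_zero, mul_one, one_mul] at h₁ h₂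
    exact ⟨h₁.symm, h₂.symm⟩
  · intro h a p
    apply hinj
    rw [map_update_const hι (k := p) (l := m - p) (by omega) e a p rfl]
    have ha := h.2 _ ⟨a, rfl⟩
    exact H.pow_mul_mul_pow_eq ⟨e, rfl⟩ ⟨a, rfl⟩ ha.1 ha.2 (by omega)

theorem pow_mul_mul_mem_range (hι : ∀ x, ι (F x) = (List.ofFn fun i => ι (x i)).prod)
    (hm : 2 ≤ m) (e f g : X) :
    ∃ x : Fin (m + 1) → X, ι (F x) = ι e ^ (m - 1) * ι f * ι g ∧
      Set.range x ⊆ {e, f, g} := by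
  obtain ⟨k, rfl⟩ : ∃ k, m = k + 1 := ⟨m - 1, by omega⟩
  refine ⟨Fin.snoc (Fin.snoc (fun _ => e) f : Fin (k + 1) → X) g, ?_, ?_⟩
  · rw [hι, List.ofFn_succ', List.ofFn_succ']
    simp [mul_assoc]
  · rintro _ ⟨i, rfl⟩
    induction i using Fin.lastCases with
    | last => simp
    | cast i => induction i using Fin.lastCases <;> simp

end Embedding

theorem Set.encard_le_two_iff {α : Type*} {s : Set α} :
    s.encard ≤ 2 ↔ ∀ a ∈ s, ∀ b ∈ s, ∀ c ∈ s, a = b ∨ a = c ∨ b = c := by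
  constructor
  · intro h a ha b hb c hc
    by_contra! hne
    have h₃ : ({a, b, c} : Set α).encard = 3 :=
      Set.encard_eq_three.2 ⟨a, b, c, hne.1, hne.2.1, hne.2.2, rfl⟩
    have hle := (Set.encard_le_encard (s := {a, b, c}) (t := s) (by grind)).trans h
    rw [h₃] at hle
    exact absurd hle (by decide)
  · intro h
    by_contra! hlt
    obtain ⟨t, ht, h₃⟩ := Set.exists_subset_encard_eq (s := s) (k := 3)
      (two_add_one_eq_three (R := ℕ∞) ▸ Order.add_one_le_of_lt hlt)
    obtain ⟨a, b, c, hab, hac, hbc, rfl⟩ := Set.encard_eq_three.1 h₃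
    have := h a (ht (by simp)) b (ht (by simp)) c (ht (by simp))
    tauto

/-- An associative operation quasitrivial on `D^n_{n-1}` is quasitrivial iff it has at most
two neutral elements. -/
theorem stmt_11 {X : Type*} [Nonempty X] (n : ℕ) (hn : 3 ≤ n)
    (F : (Fin n → X) → X) (hF : NAryAssociative n F)
    (hQ : NAryQuasitrivialOnD n (n - 1) F) :
    NAryQuasitrivial n F ↔ (naryNeutralSet n F).encard ≤ 2 := by
  obtain ⟨m, rfl⟩ : ∃ m, n = m + 1 := ⟨n - 1, by omega⟩
  have hm : 2 ≤ m := by omega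
  obtain ⟨M, _, ι, hinj, hι⟩ := hF.exists_monoid (by omega)
  have H : SandwichClosed m (Set.range ι) := hQ.sandwichClosed hι
  have hN := naryNeutral_iff_isPowNeutral hinj hι H
  rw [Set.encard_le_two_iff]
  constructor
  · intro hqt e he f hf g hg
    by_contra! hne
    rw [naryNeutralSet, Set.mem_ofPred_eq, hN] at he hf hg
    have key (a b : X) (ha : IsPowNeutral m (Set.range ι) (ι a))
        (hb : IsPowNeutral m (Set.range ι) (ι b)) (hea : e ≠ a) (heb : e ≠ b) :
        ι a * ι b = ι e * ι e := by
      obtain ⟨x, hx, hxs⟩ := pow_mul_mul_mem_range hι hm e a b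
      refine he.mul_eq_sq H hm ha hb (hinj.ne hea) (hinj.ne heb) ?_
      rw [← hx]
      have := hxs (hqt x)
      simp only [Set.mem_insert_iff, Set.mem_singleton_iff, hinj.eq_iff] at this ⊢
      exact this
    have hfg := (key f f hf hf hne.1 hne.1).trans (key f g hf hg hne.1 hne.2.1).symm
    exact hne.2.2 (hinj (hf.mul_left_cancel (by omega) hf.1 hg.1 hfg))
  · intro h x
    have htwo (e f g : M) (he : IsPowNeutral m (Set.range ι) e)
        (hf : IsPowNeutral m (Set.range ι) f) (hg : IsPowNeutral m (Set.range ι) g) :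
        e = f ∨ e = g ∨ f = g := by
      obtain ⟨e, rfl⟩ := he.1
      obtain ⟨f, rfl⟩ := hf.1
      obtain ⟨g, rfl⟩ := hg.1
      simpa only [hinj.eq_iff] using h e ((hN e).2 he) f ((hN f).2 hf) g ((hN g).2 hg)
    have hsq (e f : M) (he : IsPowNeutral m (Set.range ι) e)
        (hf : IsPowNeutral m (Set.range ι) f) : f * f = e * e := by
      by_cases hef : e = f
      · rw [hef]
      have hmem : e ^ (m - 1) * f * f ∈ Set.range ι := by
        obtain ⟨a, rfl⟩ := he.1
        obtain ⟨b, rfl⟩ := hf.1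
        obtain ⟨y, hy, -⟩ := pow_mul_mul_mem_range hι hm a b b
        exact ⟨F y, hy⟩
      have hg := he.pow_mul_sq H (by omega) hf hmem
      refine he.mul_eq_sq H hm hf hf hef hef ?_
      rcases htwo e f _ he hf hg with h' | h' | h'
      · exact absurd h' hef
      · exact .inl h'.symm
      · exact .inr (.inl h'.symm)
    rcases H.prod_eq (by omega) hsq htwo m (List.ofFn fun i => ι (x i))
      (by simp [List.mem_ofFn]) (by simp) with ⟨z, hz, hp⟩ | ⟨e, -, f, hfl, he, hf, -, hp⟩
    · obtain ⟨i, rfl⟩ := List.mem_ofFn.1 hz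
      rw [← hι, H.pow_succ_eq ⟨_, rfl⟩] at hp
      exact ⟨i, (hinj hp).symm⟩
    · obtain ⟨i, rfl⟩ := List.mem_ofFn.1 hfl
      rw [← hι, (he.2 _ hf.1).1] at hp
      exact ⟨i, (hinj hp).symm⟩
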